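/- Let d ≥ 1, let A : ℝ^d → ℝ^d be an invertible linear map, let μ ∈ ℝ^d, let p ∈ (0, 1), and let Q_R : [0, 1) → [0, ∞) be a continuous, strictly increasing function with Q_R(0) = 0. Define T : ℝ^d → ℝ^d by T(0) := μ and T(u) := μ + A( (u/‖u‖) · Q_R(‖u‖) ) for u ≠ 0. Then the image T({u ∈ ℝ^d : ‖u‖ ≤ p}) equals μ + A(closed ball of radius Q_R(p) centered at 0), and its Lebesgue measure equals |det A| · (π^{d/2} / Γ(1 + d/2)) · Q_R(p)^d. -/

import Mathlib

/-- A radial map `u ↦ (f ‖u‖ / ‖u‖) • u` with continuous increasing profile `f`, `f 0 = 0`, sends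
the closed ball of radius `p` onto the closed ball of radius `f p`. -/
theorem image_radial_closedBall {E : Type*} [NormedAddCommGroup E] [NormedSpace ℝ E]
    {f : ℝ → ℝ} {p : ℝ} (hp : 0 ≤ p) (hf : ContinuousOn f (Set.Icc 0 p))
    (hmono : MonotoneOn f (Set.Icc 0 p)) (hf0 : f 0 = 0) :
    (fun u : E => (f ‖u‖ / ‖u‖) • u) '' Metric.closedBall 0 p = Metric.closedBall 0 (f p) := by
  have h0 : (0 : ℝ) ∈ Set.Icc 0 p := Set.left_mem_Icc.2 hp
  have hpp : p ∈ Set.Icc 0 p := Set.right_mem_Icc.2 hp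
  have hfp : 0 ≤ f p := hf0 ▸ hmono h0 hpp hp
  ext z
  simp only [Set.mem_image, mem_closedBall_zero_iff]
  constructor
  · rintro ⟨u, hu, rfl⟩
    have hmem : ‖u‖ ∈ Set.Icc 0 p := ⟨norm_nonneg u, hu⟩
    have hfu : 0 ≤ f ‖u‖ := hf0 ▸ hmono h0 hmem (norm_nonneg u)
    rw [norm_smul, Real.norm_of_nonneg (div_nonneg hfu (norm_nonneg u))]
    rcases eq_or_ne u 0 with rfl | hu0
    · simpa using hfp
    · rw [div_mul_cancel₀ _ (norm_ne_zero_iff.2 hu0)]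
      exact hmono hmem hpp hu
  · intro hz
    rcases eq_or_ne z 0 with rfl | hz0
    · exact ⟨0, by simpa using hp, by simp⟩
    have hz' : ‖z‖ ≠ 0 := norm_ne_zero_iff.2 hz0
    obtain ⟨r, hr, hrz⟩ := intermediate_value_Icc hp hf
      (show ‖z‖ ∈ Set.Icc (f 0) (f p) from ⟨hf0.trans_le (norm_nonneg z), hz⟩)
    have hr0 : r ≠ 0 := by
      rintro rfl
      exact hz' (hrz.symm.trans hf0)
    have hnorm : ‖(r / ‖z‖) • z‖ = r := by
      rw [norm_smul, Real.norm_of_nonneg (div_nonneg hr.1 (norm_nonneg z)),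
        div_mul_cancel₀ _ hz']
    refine ⟨(r / ‖z‖) • z, hnorm.trans_le hr.2, ?_⟩
    rw [hnorm, hrz, smul_smul, div_mul_div_cancel₀ hr0, div_self hz', one_smul]

/-- Volume of an elliptical center-outward quantile region (Section 4 of the paper):
if `T(u) = μ + A((u/‖u‖) Q_R(‖u‖))` (with `T(0) = μ`) is the center-outward quantile
function of an elliptical distribution, then the quantile region of order `p` is
`μ + A(closed ball of radius Q_R(p))`, whose Lebesgue volume is
`|det A| · π^{d/2}/Γ(1 + d/2) · Q_R(p)^d`. -/
theorem elliptical_quantile_region_volume (d : ℕ) (hd : 1 ≤ d)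
    (A : EuclideanSpace ℝ (Fin d) ≃ₗ[ℝ] EuclideanSpace ℝ (Fin d))
    (μ : EuclideanSpace ℝ (Fin d)) (p : ℝ) (hp : p ∈ Set.Ioo (0 : ℝ) 1)
    (QR : ℝ → ℝ) (hQcont : ContinuousOn QR (Set.Ico (0 : ℝ) 1))
    (hQmono : StrictMonoOn QR (Set.Ico (0 : ℝ) 1)) (hQ0 : QR 0 = 0)
    (hQnonneg : ∀ r ∈ Set.Ico (0 : ℝ) 1, 0 ≤ QR r)
    (T : EuclideanSpace ℝ (Fin d) → EuclideanSpace ℝ (Fin d))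
    (hT0 : T 0 = μ)
    (hT : ∀ u : EuclideanSpace ℝ (Fin d), u ≠ 0 → T u = μ + A ((QR ‖u‖ / ‖u‖) • u)) :
    T '' Metric.closedBall (0 : EuclideanSpace ℝ (Fin d)) p
        = (fun z => μ + A z) '' Metric.closedBall (0 : EuclideanSpace ℝ (Fin d)) (QR p)
      ∧ MeasureTheory.volume (T '' Metric.closedBall (0 : EuclideanSpace ℝ (Fin d)) p)
        = ENNReal.ofReal
            (|LinearMap.det (A : EuclideanSpace ℝ (Fin d) →ₗ[ℝ] EuclideanSpace ℝ (Fin d))|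
              * (Real.pi ^ ((d : ℝ) / 2) / Real.Gamma (1 + (d : ℝ) / 2))
              * QR p ^ d) := by
  have hsub : Set.Icc 0 p ⊆ Set.Ico (0 : ℝ) 1 := Set.Icc_subset_Ico_right hp.2
  have hT' : T = fun u => (fun z => μ + A z) ((QR ‖u‖ / ‖u‖) • u) := by
    funext u
    rcases eq_or_ne u 0 with rfl | hu
    · simp [hT0]
    · exact hT u hu
  have himage : T '' Metric.closedBall 0 p = (fun z => μ + A z) '' Metric.closedBall 0 (QR p) := by
    rw [← image_radial_closedBall hp.1.le (hQcont.mono hsub) (hQmono.monotoneOn.mono hsub) hQ0,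
      Set.image_image, hT']
  refine ⟨himage, ?_⟩
  have hQp : 0 ≤ QR p := hQnonneg p ⟨hp.1.le, hp.2⟩
  have : Nonempty (Fin d) := Fin.pos_iff_nonempty.1 hd
  have hpi : √Real.pi ^ d = Real.pi ^ ((d : ℝ) / 2) := by
    rw [Real.sqrt_eq_rpow, ← Real.rpow_mul_natCast Real.pi_pos.le]
    ring_nf
  have hcomp : (fun z => μ + A z) '' Metric.closedBall 0 (QR p) =
      (fun z => μ + z) ''
        ((A : EuclideanSpace ℝ (Fin d) →ₗ[ℝ] EuclideanSpace ℝ (Fin d)) ''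
          Metric.closedBall 0 (QR p)) := by
    rw [Set.image_image]
    rfl
  rw [himage, hcomp, Set.image_add_left, MeasureTheory.measure_preimage_add,
    MeasureTheory.Measure.addHaar_image_linearMap, EuclideanSpace.volume_closedBall,
    Fintype.card_fin, hpi, ← ENNReal.ofReal_pow hQp, ← ENNReal.ofReal_mul (pow_nonneg hQp d),
    ← ENNReal.ofReal_mul (abs_nonneg _), add_comm (1 : ℝ)]
  ring_nf
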